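/- Let 𝒰 be a set of variables, B an atom, and 𝓗 a finite set of atoms such that for every H ∈ 𝓗 there exists a substitution θ_H with Bθ_H = Hθ_H and Var(B) ∩ Dom(θ_H) ⊆ 𝒰. Let η be an idempotent substitution with Dom(η) ⊆ Var(B), Var(η) ∩ 𝒰 = ∅, and Ran(η) ∩ Dom(θ_H η) = ∅ for every H ∈ 𝓗. Then Bη unifies with every atom of 𝓗. (This is the correctness of the maximal-unifying-substitution algorithm: further instantiation of its output that avoids the marker variables 𝒰 preserves unifiability with all positive atoms.) -/

import Mathlib

/- A model of first-order terms/atoms (atoms are modeled as terms with a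
distinguished top symbol) and finitely supported substitutions, following
the standard conventions of logic programming. -/

namespace Concolic

open FirstOrder Language

variable {L : FirstOrder.Language} {V : Type} [DecidableEq V]

/-- A substitution: a map from variables to terms (the finite-support
condition is stated separately as `IsSubst`). -/
abbrev Subst (L : FirstOrder.Language) (V : Type) : Type _ := V → L.Term V

/-- The domain of a substitution: the variables it moves. -/
def dom (σ : Subst L V) : Set V := {x | σ x ≠ Term.var x}

/-- The set of variables of a term (or atom). -/
def vars (t : L.Term V) : Set V := ↑t.varFinset

/-- The range of a substitution: variables occurring in images of its domain. -/
def ran (σ : Subst L V) : Set V := ⋃ x ∈ dom σ, vars (σ x)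

/-- Var(θ) = Dom(θ) ∪ Ran(θ). -/
def varsSubst (σ : Subst L V) : Set V := dom σ ∪ ran σ

/-- Composition of substitutions: `comp θ η` applies θ first, then η. -/
def comp (θ η : Subst L V) : Subst L V := fun x => (θ x).subst η

/-- A substitution is finitely supported: identity on all but finitely many variables. -/
def IsSubst (σ : Subst L V) : Prop := (dom σ).Finite

/-- θ is idempotent if θθ = θ. -/
def Idempotent (σ : Subst L V) : Prop := comp σ σ = σ

/-- The substitution {X/t} mapping X to t and every other variable to itself. -/
def single (X : V) (t : L.Term V) : Subst L V := fun y => if y = X then t else Term.var y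

/-- Atoms A and B are unifiable if Aσ = Bσ for some substitution σ. -/
def Unifiable (A B : L.Term V) : Prop := ∃ σ : Subst L V, IsSubst σ ∧ A.subst σ = B.subst σ

/-- s₁ is more general than s₂ (s₁ ≤ s₂) if s₁θ = s₂ for some substitution θ. -/
def MoreGen (s₁ s₂ : L.Term V) : Prop := ∃ σ : Subst L V, IsSubst σ ∧ s₁.subst σ = s₂

/-- σ is a most general unifier of A and H. -/
def IsMGU (σ : Subst L V) (A H : L.Term V) : Prop :=
  IsSubst σ ∧ A.subst σ = H.subst σ ∧
    ∀ θ : Subst L V, IsSubst θ → A.subst θ = H.subst θ →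
      ∃ δ : Subst L V, IsSubst δ ∧ θ = comp σ δ

/-- The variables of a set of atoms. -/
def varsSet (𝓑 : Set (L.Term V)) : Set V := ⋃ B ∈ 𝓑, vars B

/-- A term is ground if it contains no variables. -/
def Ground (t : L.Term V) : Prop := t.varFinset = ∅

end Concolic

namespace Concolic

open FirstOrder Language

theorem subst_comp {L : FirstOrder.Language} {V : Type} (t : L.Term V) (θ η : Subst L V) :
    t.subst (comp θ η) = (t.subst θ).subst η := by
  induction t with
  | var x => rfl
  | func f ts ih => simp [Term.subst, ih]

theorem subst_eq_self {L : FirstOrder.Language} {V : Type} [DecidableEq V]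
    (t : L.Term V) (σ : Subst L V) (h : ∀ x ∈ vars t, σ x = Term.var x) : t.subst σ = t := by
  induction t with
  | var x => exact h x (by simp [vars, Term.varFinset])
  | func f ts ih =>
    simp only [Term.subst, Term.func.injEq, heq_eq_eq, true_and]
    funext i
    refine ih i fun x hx => h x ?_
    simp only [vars, Finset.mem_coe, Term.varFinset, Finset.mem_biUnion] at hx ⊢
    exact ⟨i, Finset.mem_univ i, hx⟩

theorem IsSubst.comp {L : FirstOrder.Language} {V : Type} {θ η : Subst L V}
    (hθ : IsSubst θ) (hη : IsSubst η) : IsSubst (comp θ η) := by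
  refine (Set.Finite.union hθ hη).subset fun x hx => ?_
  by_contra h
  simp only [dom, Set.mem_union, Set.mem_ofPred_eq, not_or, not_not] at h
  exact hx (by simp [Concolic.comp, h.1, h.2, Term.subst])

/-- If `θ` fixes the domain of `η` and `θη` fixes its range, then `ηθη = θη`. -/
theorem comp_comp_eq {L : FirstOrder.Language} {V : Type} [DecidableEq V] {θ η : Subst L V}
    (hdom : ∀ x ∈ dom η, θ x = Term.var x) (hran : ∀ x ∈ ran η, comp θ η x = Term.var x) :
    comp η (comp θ η) = comp θ η := by
  funext x
  by_cases hx : x ∈ dom η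
  · have h : comp θ η x = η x := by simp [comp, hdom x hx, Term.subst]
    rw [h]
    exact subst_eq_self _ _ fun y hy => hran y (Set.mem_biUnion hx hy)
  · have h : η x = Term.var x := not_not.mp hx
    rw [comp, h, Term.subst]

/-- correctness of the maximal-unifying-substitution algorithm:
if for each H ∈ 𝓗 there is θ_H with Bθ_H = Hθ_H and Var(B) ∩ Dom(θ_H) ⊆ 𝒰, and
η is an idempotent substitution with Dom(η) ⊆ Var(B), Var(η) ∩ 𝒰 = ∅ and
Ran(η) ∩ Dom(θ_H η) = ∅ for each H ∈ 𝓗, then Bη unifies with every atom of 𝓗. -/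
theorem stmt7 {L : FirstOrder.Language} {V : Type} [DecidableEq V]
    (𝒰 : Set V) (B : L.Term V) (𝓗 : Set (L.Term V)) (hfin : 𝓗.Finite)
    (θfam : L.Term V → Subst L V)
    (hθ : ∀ H ∈ 𝓗, IsSubst (θfam H) ∧ B.subst (θfam H) = H.subst (θfam H) ∧
      vars B ∩ dom (θfam H) ⊆ 𝒰)
    (η : Subst L V) (hηfin : IsSubst η) (hidem : Idempotent η)
    (hdomη : dom η ⊆ vars B) (hvarη : varsSubst η ∩ 𝒰 = ∅)
    (hran : ∀ H ∈ 𝓗, ran η ∩ dom (comp (θfam H) η) = ∅) :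
    ∀ H ∈ 𝓗, Unifiable (B.subst η) H := by
  intro H hH
  obtain ⟨hfinθ, heq, hU⟩ := hθ H hH
  refine ⟨comp (θfam H) η, hfinθ.comp hηfin, ?_⟩
  rw [← subst_comp, comp_comp_eq, subst_comp, subst_comp, heq]
  · intro x hx
    by_contra h
    exact (Set.mem_empty_iff_false x).mp (hvarη ▸ ⟨Or.inl hx, hU ⟨hdomη hx, h⟩⟩)
  · intro x hx
    by_contra h
    exact (Set.mem_empty_iff_false x).mp (hran H hH ▸ ⟨hx, h⟩)

end Concolic
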